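/- Let Φ be an integral domain and ψ = σ₁ ∘ τ₁ ∘ σ₂ ∘ τ₂ ∘ ⋯ ∘ σ_k ∘ τ_k = (f, g) a tame automorphism of Φ[x₁,x₂], where each σ_i ∈ A₀ with σ₂, …, σ_k ≠ id, each τ_i ∈ B₀ with τ₁, …, τ_k ≠ id, and deg(τ_i) = n_i > 1. Then deg(f) = n₁⋯n_k, deg(g) = n₁⋯n_{k−1}, and deg(ψ) = n₁⋯n_k. -/

import Mathlib

open MvPolynomial

/-- The group of `Φ`-algebra automorphisms of `Φ[x₁,x₂]`. -/
abbrev PolyAut (Φ : Type*) [CommRing Φ] :=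
  MvPolynomial (Fin 2) Φ ≃ₐ[Φ] MvPolynomial (Fin 2) Φ

/-- An automorphism of `Φ[x₁,x₂]` is elementary if it has the form
`(x₁ ↦ αx₁ + f(x₂), x₂ ↦ x₂)` or `(x₁ ↦ x₁, x₂ ↦ βx₂ + g(x₁))` with `α, β` units. -/
def IsElementary {Φ : Type*} [CommRing Φ] (σ : PolyAut Φ) : Prop :=
  (∃ (α : Φˣ) (f : MvPolynomial (Fin 2) Φ), f ∈ Algebra.adjoin Φ {(X 1 : MvPolynomial (Fin 2) Φ)} ∧
      σ (X 0) = C (α : Φ) * X 0 + f ∧ σ (X 1) = X 1) ∨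
  (∃ (β : Φˣ) (g : MvPolynomial (Fin 2) Φ), g ∈ Algebra.adjoin Φ {(X 0 : MvPolynomial (Fin 2) Φ)} ∧
      σ (X 0) = X 0 ∧ σ (X 1) = C (β : Φ) * X 1 + g)

/-- The subgroup `T(P)` of tame automorphisms of `P = Φ[x₁,x₂]`. -/
noncomputable def TameSubgroup (Φ : Type*) [CommRing Φ] : Subgroup (PolyAut Φ) :=
  Subgroup.closure {σ | IsElementary σ}

/-- An automorphism is affine if it is
`(x₁ ↦ a₁x₁+b₁x₂+c₁, x₂ ↦ a₂x₁+b₂x₂+c₂)` with invertible determinant `a₁b₂ − a₂b₁`. -/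
def IsAffine {Φ : Type*} [CommRing Φ] (σ : PolyAut Φ) : Prop :=
  ∃ a₁ b₁ c₁ a₂ b₂ c₂ : Φ, IsUnit (a₁ * b₂ - a₂ * b₁) ∧
    σ (X 0) = C a₁ * X 0 + C b₁ * X 1 + C c₁ ∧
    σ (X 1) = C a₂ * X 0 + C b₂ * X 1 + C c₂

/-- An automorphism is triangular if it is `(x₁ ↦ ax₁ + h(x₂), x₂ ↦ bx₂ + b₁)`
with `a, b` units, `b₁ ∈ Φ` and `h(x₂) ∈ Φ[x₂]`. -/
def IsTriangular {Φ : Type*} [CommRing Φ] (σ : PolyAut Φ) : Prop :=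
  ∃ (a b : Φˣ) (b₁ : Φ) (h : MvPolynomial (Fin 2) Φ),
    h ∈ Algebra.adjoin Φ {(X 1 : MvPolynomial (Fin 2) Φ)} ∧
    σ (X 0) = C (a : Φ) * X 0 + h ∧ σ (X 1) = C (b : Φ) * X 1 + C b₁

/-- `B₀ = {(x₁ + h(x₂), x₂) | h(x₂) ∈ x₂²Φ[x₂]}`, a system of representatives of the left
cosets of `Tr₂(Φ)` modulo `H(Φ)`. -/
def B₀ (Φ : Type*) [CommRing Φ] : Set (PolyAut Φ) :=
  {σ | ∃ h : MvPolynomial (Fin 2) Φ, h ∈ Algebra.adjoin Φ {(X 1 : MvPolynomial (Fin 2) Φ)} ∧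
    σ (X 0) = X 0 + X 1 ^ 2 * h ∧ σ (X 1) = X 1}

/-- `A₀` is a system of representatives, containing the identity, of the left cosets of
`Af₂(Φ)` modulo `H(Φ) = Af₂(Φ) ∩ Tr₂(Φ)`. -/
def IsAffineTransversal {Φ : Type*} [CommRing Φ] (A₀ : Set (PolyAut Φ)) : Prop :=
  (1 : PolyAut Φ) ∈ A₀ ∧ (∀ a ∈ A₀, IsAffine a) ∧
    ∀ g : PolyAut Φ, IsAffine g →
      ∃! a, a ∈ A₀ ∧ IsAffine (a⁻¹ * g) ∧ IsTriangular (a⁻¹ * g)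


/-- The degree of an automorphism `φ = (f₁, f₂)`: `deg φ = max (deg f₁) (deg f₂)`. -/
noncomputable def degAut {Φ : Type*} [CommRing Φ] (σ : PolyAut Φ) : ℕ :=
  max (σ (X 0)).totalDegree ((σ (X 1)).totalDegree)

lemma totalDegree_aeval_eq_natDegree_mul {Φ σ : Type*} [CommRing Φ] [IsDomain Φ]
    {q : MvPolynomial σ Φ} (hq : 0 < q.totalDegree) {P : Polynomial Φ} (hP : P ≠ 0) :
    Polynomial.aeval q P ≠ 0 ∧
      (Polynomial.aeval q P).totalDegree = P.natDegree * q.totalDegree := by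
  induction hn : P.natDegree generalizing P with
  | zero =>
    obtain ⟨c, rfl⟩ := Polynomial.natDegree_eq_zero.mp hn
    have hc : c ≠ 0 := by rintro rfl; simp at hP
    simp [Polynomial.aeval_C, MvPolynomial.algebraMap_eq, hc]
  | succ n ih =>
    have hD : P.divX.natDegree = n := by
      rw [Polynomial.natDegree_divX_eq_natDegree_tsub_one, hn]; rfl
    have hD0 : P.divX ≠ 0 := by
      intro h
      have := Polynomial.natDegree_eq_zero.mpr ⟨_, (Polynomial.divX_eq_zero_iff.mp h).symm⟩
      omega
    obtain ⟨h0, h1⟩ := ih hD0 hD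
    have hq0 : q ≠ 0 := by rintro rfl; simp at hq
    have hmul : (Polynomial.aeval q P.divX * q).totalDegree = (n + 1) * q.totalDegree := by
      rw [totalDegree_mul_of_isDomain h0 hq0, h1]; ring
    have hpos : 0 < (n + 1) * q.totalDegree := by positivity
    have heq : Polynomial.aeval q P = Polynomial.aeval q P.divX * q + C (P.coeff 0) := by
      conv_lhs => rw [← Polynomial.divX_mul_X_add P]
      simp [MvPolynomial.algebraMap_eq]
    have hdeg : (Polynomial.aeval q P).totalDegree = (n + 1) * q.totalDegree := by
      rw [heq, totalDegree_add_eq_left_of_totalDegree_lt (by rw [hmul, totalDegree_C]; exact hpos),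
        hmul]
    refine ⟨fun h => ?_, hdeg⟩
    rw [h, totalDegree_zero] at hdeg
    omega

/-- Composing on the right with an element of `B₀` of degree `n` multiplies the degree of the
first component by `n`, provided that its degree is at most that of the second component. -/
lemma totalDegree_mul_of_mem_B₀ {Φ : Type*} [CommRing Φ] [IsDomain Φ] {φ τ : PolyAut Φ}
    (hφ : 0 < (φ (X 1)).totalDegree) (hle : (φ (X 0)).totalDegree ≤ (φ (X 1)).totalDegree)
    (hτ : τ ∈ B₀ Φ) (hdeg : 1 < degAut τ) :
    ((φ * τ) (X 0)).totalDegree = (φ (X 1)).totalDegree * degAut τ ∧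
      (φ * τ) (X 1) = φ (X 1) := by
  obtain ⟨h, hh, h0, h1⟩ := hτ
  refine ⟨?_, by rw [AlgEquiv.mul_apply, h1]⟩
  rw [Algebra.adjoin_singleton_eq_range_aeval] at hh
  obtain ⟨Q, rfl⟩ := hh
  obtain ⟨P, hP⟩ : ∃ P : Polynomial Φ, P = Polynomial.X ^ 2 * Q := ⟨_, rfl⟩
  have hτ0 : τ (X 0) = X 0 + Polynomial.aeval (X 1) P := by rw [h0, hP]; simp
  have hPn : P.natDegree = degAut τ := by
    rcases eq_or_ne P 0 with hP0 | hP0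
    · simp [degAut, hτ0, h1, hP0] at hdeg
    · have hd := (totalDegree_aeval_eq_natDegree_mul (q := (X 1 : MvPolynomial (Fin 2) Φ))
        (by simp) hP0).2
      rw [totalDegree_X, mul_one] at hd
      have h2 : 2 ≤ P.natDegree := by
        have hQ : Q ≠ 0 := by rintro rfl; simp at hP; exact hP0 hP
        rw [hP, Polynomial.natDegree_mul (by simp) hQ]
        simp
      rw [degAut, hτ0, h1, totalDegree_add_eq_right_of_totalDegree_lt
        (by rw [hd, totalDegree_X]; omega), hd, totalDegree_X]
      omega
  have hP0 : P ≠ 0 := by rintro rfl; simp at hPn; omega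
  have hd := (totalDegree_aeval_eq_natDegree_mul hφ hP0).2
  have heq : (φ * τ) (X 0) = φ (X 0) + Polynomial.aeval (φ (X 1)) P := by
    rw [AlgEquiv.mul_apply, hτ0, map_add, ← Polynomial.aeval_algHom_apply φ]
  rw [heq, totalDegree_add_eq_right_of_totalDegree_lt (by rw [hd, hPn]; nlinarith), hd, hPn,
    mul_comm]

/-- The only triangular representative is the identity. -/
lemma IsAffineTransversal.eq_one_of_triangular {Φ : Type*} [CommRing Φ] {A₀ : Set (PolyAut Φ)}
    (hA₀ : IsAffineTransversal A₀) {σ : PolyAut Φ} (hσ : σ ∈ A₀) (ht : IsTriangular σ) :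
    σ = 1 := by
  have hid : IsAffine (1 : PolyAut Φ) := ⟨1, 0, 0, 0, 1, 0, by simp, by simp, by simp⟩
  have hidt : IsTriangular (1 : PolyAut Φ) := ⟨1, 1, 0, 0, zero_mem _, by simp, by simp⟩
  have haff := hA₀.2.1 σ hσ
  exact (hA₀.2.2 σ haff).unique ⟨hσ, by simpa using hid, by simpa using hidt⟩
    ⟨hA₀.1, by simpa using haff, by simpa using ht⟩

/-- The second component of a representative other than the identity involves `x₁`. -/
lemma IsAffineTransversal.exists_ne_zero {Φ : Type*} [CommRing Φ] {A₀ : Set (PolyAut Φ)}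
    (hA₀ : IsAffineTransversal A₀) {σ : PolyAut Φ} (hσ : σ ∈ A₀) (hne : σ ≠ 1) :
    ∃ a₁ b₁ c₁ a₂ b₂ c₂ : Φ, a₂ ≠ 0 ∧
      σ (X 0) = C a₁ * X 0 + C b₁ * X 1 + C c₁ ∧
      σ (X 1) = C a₂ * X 0 + C b₂ * X 1 + C c₂ := by
  obtain ⟨a₁, b₁, c₁, a₂, b₂, c₂, hu, h0, h1⟩ := hA₀.2.1 σ hσ
  refine ⟨a₁, b₁, c₁, a₂, b₂, c₂, ?_, h0, h1⟩
  rintro rfl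
  rw [zero_mul, sub_zero, IsUnit.mul_iff] at hu
  refine hne (hA₀.eq_one_of_triangular hσ ⟨hu.1.unit, hu.2.unit, c₂, C b₁ * X 1 + C c₁, ?_, ?_, ?_⟩)
  · exact add_mem (mul_mem (Subalgebra.algebraMap_mem _ b₁)
      (Algebra.subset_adjoin (Set.mem_singleton _))) (Subalgebra.algebraMap_mem _ c₁)
  · rw [h0, add_assoc]; rfl
  · rw [h1]; simp

lemma totalDegree_C_mul_le {Φ σ : Type*} [CommRing Φ] (a : Φ) (p : MvPolynomial σ Φ) :
    (C a * p).totalDegree ≤ p.totalDegree :=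
  (totalDegree_mul _ _).trans (by simp)

lemma totalDegree_affine_le {Φ σ : Type*} [CommRing Φ] (a b c : Φ) (p q : MvPolynomial σ Φ) :
    (C a * p + C b * q + C c).totalDegree ≤ max p.totalDegree q.totalDegree :=
  (totalDegree_add _ _).trans <| max_le ((totalDegree_add _ _).trans
    (max_le_max (totalDegree_C_mul_le a p) (totalDegree_C_mul_le b q))) (by simp)

lemma totalDegree_affine_eq_left {Φ σ : Type*} [CommRing Φ] [IsDomain Φ] {a : Φ} (ha : a ≠ 0)
    (b c : Φ) {p q : MvPolynomial σ Φ} (hlt : q.totalDegree < p.totalDegree) :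
    (C a * p + C b * q + C c).totalDegree = p.totalDegree := by
  have hp : p ≠ 0 := by rintro rfl; simp at hlt
  have hap : (C a * p).totalDegree = p.totalDegree := by
    rw [totalDegree_mul_of_isDomain (by simpa using ha) hp]; simp
  have hbq := totalDegree_C_mul_le b q
  rw [add_assoc, totalDegree_add_eq_left_of_totalDegree_lt, hap]
  refine (totalDegree_add _ _).trans_lt (max_lt ?_ ?_)
  · omega
  · rw [totalDegree_C]; omega

lemma IsAffine.totalDegree_eq_one {Φ : Type*} [CommRing Φ] [IsDomain Φ] {σ : PolyAut Φ}
    (hσ : IsAffine σ) :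
    (σ (X 1)).totalDegree = 1 ∧ (σ (X 0)).totalDegree ≤ 1 := by
  obtain ⟨a₁, b₁, c₁, a₂, b₂, c₂, -, h0, h1⟩ := hσ
  have hle0 := totalDegree_affine_le a₁ b₁ c₁ (X 0 : MvPolynomial (Fin 2) Φ) (X 1)
  have hle1 := totalDegree_affine_le a₂ b₂ c₂ (X 0 : MvPolynomial (Fin 2) Φ) (X 1)
  rw [← h0, totalDegree_X, totalDegree_X] at hle0
  rw [← h1, totalDegree_X, totalDegree_X] at hle1
  refine ⟨le_antisymm hle1 (Nat.one_le_iff_ne_zero.mpr fun hz => ?_), hle0⟩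
  rw [totalDegree_eq_zero_iff_eq_C] at hz
  have hX : (X 1 : MvPolynomial (Fin 2) Φ) = C (coeff 0 (σ (X 1))) := by
    apply σ.injective
    rw [hz]
    simpa using (σ.commutes (coeff 0 (σ (X 1)))).symm
  have := congrArg totalDegree hX
  simp at this

/-- If `ψ = σ₁ ∘ τ₁ ∘ σ₂ ∘ τ₂ ∘ ⋯ ∘ σ_k ∘ τ_k = (f, g)` with `σᵢ ∈ A₀`, `σ₂, …, σ_k ≠ id`,
`τᵢ ∈ B₀`, `τ₁, …, τ_k ≠ id` and `deg τᵢ = nᵢ > 1`, then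
`deg f = n₁⋯n_k`, `deg g = n₁⋯n_{k−1}` and `deg ψ = n₁⋯n_k`. -/
theorem degree_of_tame_automorphism_decomposition
    (Φ : Type*) [CommRing Φ] [IsDomain Φ]
    (A₀ : Set (PolyAut Φ)) (hA₀ : IsAffineTransversal A₀)
    (l : List (PolyAut Φ × PolyAut Φ)) (hl : l ≠ [])
    (hmem : ∀ p ∈ l, p.1 ∈ A₀ ∧ p.2 ∈ B₀ Φ ∧ p.2 ≠ 1)
    (htail : ∀ p ∈ l.tail, p.1 ≠ 1)
    (hdeg : ∀ p ∈ l, 1 < degAut p.2)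
    (ψ : PolyAut Φ) (hψ : ψ = (l.map fun p => p.1 * p.2).prod) :
    (ψ (X 0)).totalDegree = (l.map fun p => degAut p.2).prod ∧
    (ψ (X 1)).totalDegree = ((l.map fun p => degAut p.2).dropLast).prod ∧
    degAut ψ = (l.map fun p => degAut p.2).prod := by
  subst hψ
  suffices h : (((l.map fun p : PolyAut Φ × PolyAut Φ => p.1 * p.2).prod : PolyAut Φ)
        (X 0)).totalDegree = (l.map fun p => degAut p.2).prod ∧
      (((l.map fun p : PolyAut Φ × PolyAut Φ => p.1 * p.2).prod : PolyAut Φ)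
        (X 1)).totalDegree = ((l.map fun p => degAut p.2).dropLast).prod ∧
      (((l.map fun p : PolyAut Φ × PolyAut Φ => p.1 * p.2).prod : PolyAut Φ)
        (X 1)).totalDegree <
      (((l.map fun p : PolyAut Φ × PolyAut Φ => p.1 * p.2).prod : PolyAut Φ)
        (X 0)).totalDegree from
    ⟨h.1, h.2.1, by rw [degAut, max_eq_left h.2.2.le, h.1]⟩
  induction l using List.reverseRecOn with
  | nil => exact absurd rfl hl
  | append_singleton l p ih =>
    obtain ⟨hpA, hpB, -⟩ := hmem p (by simp)
    have hpd := hdeg p (by simp)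
    obtain ⟨ρ, hρ⟩ : ∃ ρ : PolyAut Φ, ρ = (l.map fun p => p.1 * p.2).prod := ⟨_, rfl⟩
    obtain ⟨d, hd⟩ : ∃ d, d = (l.map fun p => degAut p.2).prod := ⟨_, rfl⟩
    have key : 0 < d ∧ ((ρ * p.1) (X 1)).totalDegree = d ∧
        ((ρ * p.1) (X 0)).totalDegree ≤ d := by
      rcases eq_or_ne l [] with rfl | hl'
      · obtain ⟨h1, h0⟩ := (hA₀.2.1 _ hpA).totalDegree_eq_one
        simp only [List.map_nil, List.prod_nil] at hρ hd
        subst hρ hd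
        simpa using ⟨h1, h0⟩
      · have htl : (l ++ [p]).tail = l.tail ++ [p] := List.tail_append_of_ne_nil hl'
        obtain ⟨h0, -, hlt⟩ := ih hl' (fun q hq => hmem q (by simp [hq]))
          (fun q hq => htail q (by simp [htl, hq])) (fun q hq => hdeg q (by simp [hq]))
        rw [← hρ, ← hd] at h0
        rw [← hρ] at hlt
        obtain ⟨a₁, b₁, c₁, a₂, b₂, c₂, ha, e0, e1⟩ :=
          hA₀.exists_ne_zero hpA (htail p (by simp [htl]))
        have hC (a : Φ) : ρ (C a) = C a := ρ.commutes a
        refine ⟨by omega, ?_, ?_⟩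
        · rw [AlgEquiv.mul_apply, e1]
          simp only [map_add, map_mul, hC]
          rw [totalDegree_affine_eq_left ha _ _ hlt, h0]
        · rw [AlgEquiv.mul_apply, e0]
          simp only [map_add, map_mul, hC]
          exact (totalDegree_affine_le _ _ _ _ _).trans (by omega)
    obtain ⟨hd0, h1, h0⟩ := key
    obtain ⟨e0, e1⟩ := totalDegree_mul_of_mem_B₀ (φ := ρ * p.1) (by omega) (by omega) hpB hpd
    rw [mul_assoc] at e0 e1
    simp only [List.map_append, List.map_cons, List.map_nil, List.prod_append, List.prod_singleton,
      List.dropLast_concat, ← hρ, ← hd, e0, e1, h1, true_and]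
    nlinarith
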